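/- arXiv:1903.04973 — 2 statements merged into one kernel-verified Lean document; each statement's English description precedes it below -/
import Mathlib

section
/- Ehrenborg–van Willigenburg's theorem: Let G be a Ferrers graph whose vertex set is partitioned as V(G) = R ⊔ C with R = {r₁, ..., r_m} and C = {c₁, ..., c_n}. Then the number of spanning trees of G satisfies m·n·τ(G) = ∏_{v ∈ V(G)} deg(v), equivalently τ(G) = ∏_{i=2}^{m} deg(r_i) · ∏_{j=2}^{n} deg(c_j). -/
/-- The number of spanning trees of a simple graph `G`: the number of subgraphs of `G`
that contain every vertex and are trees (connected and acyclic). -/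
noncomputable def spanningTreeCount {V : Type*} (G : SimpleGraph V) : ℕ :=
  Nat.card {T : G.Subgraph // T.IsSpanning ∧ T.coe.IsTree}

/-- A graph on the vertex set `Fin (m+1) ⊕ Fin (n+1)` (row vertices `r₁,…,r_{m+1}` and
column vertices `c₁,…,c_{n+1}`, zero-indexed) is a Ferrers graph if it is bipartite with
all edges between the two parts, its edges are "left-justified and top-justified"
(if `{r_k, c_ℓ}` is an edge then so is `{r_i, c_j}` for all `i ≤ k`, `j ≤ ℓ`), and it
contains the corner edges `{r₁, c_{n+1}}` and `{r_{m+1}, c₁}`. -/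
def IsFerrersGraph {m n : ℕ} (G : SimpleGraph (Fin (m + 1) ⊕ Fin (n + 1))) : Prop :=
  (∀ a b : Fin (m + 1), ¬ G.Adj (Sum.inl a) (Sum.inl b)) ∧
  (∀ a b : Fin (n + 1), ¬ G.Adj (Sum.inr a) (Sum.inr b)) ∧
  (∀ (k i : Fin (m + 1)) (l j : Fin (n + 1)),
      G.Adj (Sum.inl k) (Sum.inr l) → i ≤ k → j ≤ l → G.Adj (Sum.inl i) (Sum.inr j)) ∧
  G.Adj (Sum.inl 0) (Sum.inr (Fin.last n)) ∧ G.Adj (Sum.inl (Fin.last m)) (Sum.inr 0)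

open Matrix Finset

section Determinants

variable {V R : Type*} [Fintype V] [DecidableEq V] [CommRing R]

/-- A matrix which is strictly triangular off the diagonal with respect to a (not necessarily
injective) ranking of its indices has determinant the product of its diagonal entries. -/
theorem Matrix.det_eq_prod_diag_of_rank {α : Type*} [LinearOrder α] (M : Matrix V V R) (b : V → α)
    (h : ∀ i j, i ≠ j → b j ≤ b i → M i j = 0) : M.det = ∏ i, M i i := by
  have hM : BlockTriangular M b := fun i j hij ↦ h i j (fun e ↦ by simp [e] at hij) hij.le
  have hblock (a : α) :
      (M.toSquareBlock b a).det = ∏ i : {i // b i = a}, M i i := by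
    have : M.toSquareBlock b a = diagonal fun i : {i // b i = a} ↦ M i i := by
      ext i j
      rcases eq_or_ne i j with rfl | hij
      · simp [toSquareBlock_def]
      · rw [diagonal_apply_ne _ hij, toSquareBlock_def, of_apply]
        exact h i j (fun e ↦ hij (Subtype.ext e)) (by rw [i.2, j.2])
    rw [this, det_diagonal]
  rw [hM.det]
  simp_rw [hblock]
  rw [← Finset.prod_fiberwise_of_maps_to (g := b) (t := univ.image b)
    (fun i _ ↦ mem_image_of_mem b (mem_univ i))]
  refine Finset.prod_congr rfl fun a _ ↦ ?_
  exact (Finset.prod_subtype _ (by simp) fun i ↦ M i i).symm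

/-- If all rows and all columns of `L` sum to zero, the determinant of a rank-one perturbation of
`L` is a multiple of the principal minor of `L` at any chosen index. -/
theorem Matrix.det_add_vecMulVec_of_sum_eq_zero [IsDomain R] (L : Matrix V V R)
    (hcol : ∀ j, ∑ i, L i j = 0) (hrow : ∀ i, ∑ j, L i j = 0) (a b : V → R) (r : V) :
    (L + vecMulVec a b).det =
      (∑ i, a i) * (∑ j, b j) * (L.updateRow r (Pi.single r 1)).det := by
  have hsum : (L + vecMulVec a b).det =
      ((L + vecMulVec a b).updateRow r ((∑ i, a i) • b)).det := by
    have := det_updateRow_sum (L + vecMulVec a b) r fun _ ↦ 1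
    rw [one_smul] at this
    rw [← this]
    congr 2
    ext j
    simp only [one_smul, Pi.smul_apply, smul_eq_mul]
    refine (Finset.sum_apply j univ fun i ↦ (L + vecMulVec a b) i).trans ?_
    simp [Finset.sum_add_distrib, hcol, vecMulVec_apply, Finset.sum_mul]
  have hclear : ((L + vecMulVec a b).updateRow r b).det = (L.updateRow r b).det := by
    refine det_eq_of_forall_row_eq_smul_add_const (Function.update a r 0) r (by simp) fun i j ↦ ?_
    rcases eq_or_ne i r with rfl | hi
    · simp
    · simp [hi, vecMulVec_apply]
  have hker : (L.updateRow r (b - (∑ j, b j) • Pi.single r 1)).det = 0 := by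
    refine exists_mulVec_eq_zero_iff.mp ⟨fun _ ↦ 1, fun h ↦ one_ne_zero (congrFun h r), ?_⟩
    ext i
    rcases eq_or_ne i r with rfl | hi
    · simp [mulVec, dotProduct, Finset.sum_sub_distrib, Pi.single_apply]
    · simp [mulVec, dotProduct, hi, hrow]
  have hlin : (L.updateRow r b).det = (∑ j, b j) * (L.updateRow r (Pi.single r 1)).det := by
    have := det_updateRow_add L r (b - (∑ j, b j) • Pi.single r 1) ((∑ j, b j) • Pi.single r 1)
    rw [sub_add_cancel, hker, zero_add, det_updateRow_smul] at this
    exact this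
  rw [hsum, det_updateRow_smul, hclear, hlin, mul_assoc]

end Determinants

namespace SimpleGraph

variable {V : Type*}

/-- `f` sends each vertex other than `r` to a neighbor and, when iterated, every vertex
to `r`. -/
structure IsParentMap (G : SimpleGraph V) (r : V) (f : V → V) : Prop where
  map_root : f r = r
  adj : ∀ v, v ≠ r → G.Adj v (f v)
  reaches : ∀ v, ∃ k, f^[k] v = r

/-- The graph joining each vertex to its image under `f`. -/
def parentGraph (f : V → V) : SimpleGraph V := SimpleGraph.fromRel fun u v ↦ f u = v

theorem parentGraph_adj {f : V → V} {u v : V} :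
    (parentGraph f).Adj u v ↔ u ≠ v ∧ (f u = v ∨ f v = u) :=
  SimpleGraph.fromRel_adj _ _ _

namespace IsParentMap

variable {G : SimpleGraph V} {r : V} {f g : V → V}

theorem map_ne (hf : G.IsParentMap r f) {v : V} (hv : v ≠ r) : f v ≠ v :=
  (hf.adj v hv).ne'

theorem ne_root_of_map_ne (hf : G.IsParentMap r f) {v : V} (hv : f v ≠ v) : v ≠ r := by
  rintro rfl
  exact hv hf.map_root

theorem parentGraph_le (hf : G.IsParentMap r f) : parentGraph f ≤ G := by
  intro u v h
  obtain ⟨hne, rfl | rfl⟩ := parentGraph_adj.mp h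
  · exact hf.adj u (hf.ne_root_of_map_ne hne.symm)
  · exact (hf.adj v (hf.ne_root_of_map_ne hne)).symm

theorem connected (hf : G.IsParentMap r f) : (parentGraph f).Connected := by
  have hstep (v : V) : (parentGraph f).Reachable v (f v) := by
    by_cases h : v = f v
    · rw [← h]
    · exact (parentGraph_adj.mpr ⟨h, .inl rfl⟩ : (parentGraph f).Adj v (f v)).reachable
  have hiter (k : ℕ) (v : V) : (parentGraph f).Reachable v (f^[k] v) := by
    induction k with
    | zero => rfl
    | succ k ih => rw [Function.iterate_succ_apply']; exact ih.trans (hstep _)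
  refine SimpleGraph.connected_iff_exists_forall_reachable _ |>.mpr ⟨r, fun v ↦ ?_⟩
  obtain ⟨k, hk⟩ := hf.reaches v
  exact hk ▸ (hiter k v).symm

theorem isTree [Finite V] (hf : G.IsParentMap r f) : (parentGraph f).IsTree := by
  classical
  cases nonempty_fintype V
  refine isTree_iff_connected_and_card.mpr
    ⟨hf.connected, le_antisymm ?_ hf.connected.card_vert_le_card_edgeSet_add_one⟩
  have hsub : (parentGraph f).edgeSet ⊆
      ((univ.erase r).image fun v ↦ s(v, f v) : Finset (Sym2 V)) := by
    intro e
    induction e with | h u v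
    rw [mem_edgeSet, parentGraph_adj]
    rintro ⟨hne, rfl | rfl⟩
    · simpa using ⟨u, hf.ne_root_of_map_ne hne.symm, by simp⟩
    · simpa using ⟨v, hf.ne_root_of_map_ne hne, by simp⟩
  have hcard : Nat.card (parentGraph f).edgeSet ≤ (univ.erase r).card := by
    refine (Nat.card_mono (Finset.finite_toSet _) hsub).trans ?_
    rw [Nat.card_coe_set_eq, Set.ncard_coe_finset]
    exact Finset.card_image_le
  rw [Finset.card_erase_of_mem (mem_univ r), Finset.card_univ] at hcard
  have : 0 < Fintype.card V := Fintype.card_pos_iff.mpr ⟨r⟩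
  rw [Nat.card_eq_fintype_card (α := V)]
  omega

theorem eq_of_parentGraph_eq (hf : G.IsParentMap r f) (hg : G.IsParentMap r g)
    (h : parentGraph f = parentGraph g) : f = g := by
  suffices ∀ (k : ℕ) (v : V), f^[k] v = r → f v = g v by
    ext v
    obtain ⟨k, hk⟩ := hf.reaches v
    exact this k v hk
  intro k
  induction k with
  | zero =>
    rintro v rfl
    exact hf.map_root.trans hg.map_root.symm
  | succ k ih =>
    intro v hv
    have hfg := ih (f v) hv
    by_cases hvr : v = r
    · rw [hvr, hf.map_root, hg.map_root]
    have hadj : (parentGraph g).Adj v (f v) :=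
      h ▸ parentGraph_adj.mpr ⟨(hf.map_ne hvr).symm, .inl rfl⟩
    obtain ⟨-, hgv | hgv⟩ := parentGraph_adj.mp hadj
    · exact hgv.symm
    · exfalso
      -- Here `v` lies on a two-cycle of `f`.
      have hcycle : f (f v) = v := hfg.trans hgv
      have hmem (k : ℕ) : f^[k] v = v ∨ f^[k] v = f v := by
        induction k with
        | zero => exact .inl rfl
        | succ k ih =>
          rw [Function.iterate_succ_apply']
          rcases ih with e | e <;> simp [e, hcycle]
      obtain ⟨k, hk⟩ := hf.reaches v
      rcases hmem k with e | e
      · exact hvr (e.symm.trans hk)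
      · have hfr : f v = r := e.symm.trans hk
        rw [hfr, hf.map_root] at hcycle
        exact hvr hcycle.symm

end IsParentMap

theorem IsTree.exists_isParentMap [Finite V] {G T : SimpleGraph V} (hT : T.IsTree) (hle : T ≤ G)
    (r : V) : ∃ f, G.IsParentMap r f ∧ parentGraph f = T := by
  classical
  have hnext (v : V) : ∃ w, (v = r → w = r) ∧ (v ≠ r → T.Adj v w ∧ T.dist w r < T.dist v r) := by
    rcases eq_or_ne v r with rfl | hv
    · exact ⟨v, by simp⟩
    obtain ⟨p, hp⟩ := hT.connected.exists_walk_length_eq_dist v r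
    cases p with
    | nil => exact absurd rfl hv
    | @cons _ w _ hadj q =>
      refine ⟨w, fun h ↦ absurd h hv, fun _ ↦ ⟨hadj, ?_⟩⟩
      have := dist_le q
      rw [Walk.length_cons] at hp
      omega
  choose f hfr hf using hnext
  have hreach (n : ℕ) : ∀ v, T.dist v r = n → ∃ k, f^[k] v = r := by
    induction n using Nat.strong_induction_on with
    | _ n ih =>
      rintro v rfl
      rcases eq_or_ne v r with rfl | hv
      · exact ⟨0, rfl⟩
      · obtain ⟨k, hk⟩ := ih _ (hf v hv).2 _ rfl
        exact ⟨k + 1, hk⟩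
  have hfT : T.IsParentMap r f := ⟨hfr r rfl, fun v hv ↦ (hf v hv).1, fun v ↦ hreach _ v rfl⟩
  refine ⟨f, ⟨hfT.map_root, fun v hv ↦ hle (hfT.adj v hv), hfT.reaches⟩, ?_⟩
  exact ((isTree_iff_minimal_connected.mp hT).eq_of_ge hfT.connected hfT.parentGraph_le).symm

/-- Spanning trees of `G`, as subgraphs, correspond to trees on the same vertices below `G`. -/
def spanningTreeEquiv (G : SimpleGraph V) :
    {T : G.Subgraph // T.IsSpanning ∧ T.coe.IsTree} ≃ {T : SimpleGraph V // T ≤ G ∧ T.IsTree} where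
  toFun T := ⟨T.1.spanningCoe, T.1.spanningCoe_le,
    (T.1.spanningCoeEquivCoeOfSpanning T.2.1).isTree_iff.mpr T.2.2⟩
  invFun T := ⟨toSubgraph T.1 T.2.1, fun _ ↦ trivial,
    ((toSubgraph T.1 T.2.1).spanningCoeEquivCoeOfSpanning fun _ ↦ trivial).isTree_iff.mp T.2.2⟩
  left_inv T := Subtype.ext <| Subgraph.ext
    (Set.eq_univ_of_forall T.2.1).symm rfl
  right_inv _ := rfl

theorem spanningTreeCount_eq_card_isParentMap [Finite V] (G : SimpleGraph V) (r : V) :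
    spanningTreeCount G = Nat.card {f : V → V // G.IsParentMap r f} := by
  rw [spanningTreeCount, Nat.card_congr G.spanningTreeEquiv]
  refine (Nat.card_eq_of_bijective
    (fun f : {f : V → V // G.IsParentMap r f} ↦
      (⟨parentGraph f.1, f.2.parentGraph_le, f.2.isTree⟩ : {T : SimpleGraph V // T ≤ G ∧ T.IsTree}))
    ⟨fun f g h ↦ ?_, fun T ↦ ?_⟩).symm
  · exact Subtype.ext (f.2.eq_of_parentGraph_eq g.2 (congrArg Subtype.val h))
  · obtain ⟨f, hf, hfT⟩ := T.2.2.exists_isParentMap T.2.1 r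
    exact ⟨⟨f, hf⟩, Subtype.ext hfT⟩

section MatrixTree

variable [Fintype V] [DecidableEq V]

/-- Row `v` of the matrix `1 - P`, where `P` is the matrix of the partial map that is `f` away
from `r` and undefined at `r`. -/
def parentRow (r v w : V) : V → ℤ :=
  if v = r then Pi.single r 1 else Pi.single v 1 - Pi.single w 1

theorem det_parentRow_of_reaches {r : V} {f : V → V} (hr : f r = r) (hne : ∀ v, v ≠ r → f v ≠ v)
    (h : ∀ v, ∃ k, f^[k] v = r) :
    (Matrix.of fun v ↦ parentRow r v (f v)).det = 1 := by
  rw [Matrix.det_eq_prod_diag_of_rank _ (fun v ↦ OrderDual.toDual (Nat.find (h v)))]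
  · refine Finset.prod_eq_one fun v _ ↦ ?_
    by_cases hv : v = r
    · simp [parentRow, hv]
    · simp [parentRow, hv, hne v hv]
  · intro v w hvw hle
    by_cases hv : v = r
    · subst hv
      simp [parentRow, hvw.symm]
    · have hw : w ≠ f v := by
        rintro rfl
        have hpos : 0 < Nat.find (h v) := by
          rw [Nat.find_pos]
          exact hv
        have hlt : Nat.find (h (f v)) ≤ Nat.find (h v) - 1 := by
          refine Nat.find_min' _ ?_
          rw [← Function.iterate_succ_apply, Nat.succ_eq_add_one, Nat.sub_add_cancel hpos]
          exact Nat.find_spec (h v)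
        have : Nat.find (h v) ≤ Nat.find (h (f v)) := hle
        omega
      simp [parentRow, hv, hvw.symm, hw]

theorem det_parentRow_of_not_reaches {r : V} {f : V → V}
    (h : ¬ ∀ v, ∃ k, f^[k] v = r) :
    (Matrix.of fun v ↦ parentRow r v (f v)).det = 0 := by
  classical
  push Not at h
  obtain ⟨u, hu⟩ := h
  refine Matrix.exists_mulVec_eq_zero_iff.mp
    ⟨fun v ↦ if ∃ k, f^[k] v = r then 0 else 1, fun e ↦ ?_, ?_⟩
  · have := congrFun e u
    simp [hu] at this
  · ext v
    by_cases hv : v = r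
    · have : ∃ k, f^[k] r = r := ⟨0, rfl⟩
      simp [Matrix.mulVec, parentRow, hv, this]
    · have : (∃ k, f^[k] (f v) = r) ↔ ∃ k, f^[k] v = r := by
        refine ⟨fun ⟨k, hk⟩ ↦ ⟨k + 1, hk⟩, fun ⟨k, hk⟩ ↦ ?_⟩
        cases k with
        | zero => exact absurd hk hv
        | succ k => exact ⟨k, hk⟩
      have hrow : parentRow r v (f v) = Pi.single v 1 - Pi.single (f v) 1 := if_neg hv
      simp only [Matrix.mulVec, of_apply]
      rw [hrow, sub_dotProduct]
      simp [this]

/-- Kirchhoff's matrix-tree theorem. -/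
theorem det_lapMatrix_updateRow (G : SimpleGraph V) [DecidableRel G.Adj] (r : V) :
    ((G.lapMatrix ℤ).updateRow r (Pi.single r 1)).det = spanningTreeCount G := by
  classical
  let A (v : V) : Finset V := if v = r then {r} else G.neighborFinset v
  have hrows : (G.lapMatrix ℤ).updateRow r (Pi.single r 1) =
      Matrix.of fun v ↦ ∑ w ∈ A v, parentRow r v w := by
    ext v w
    rcases eq_or_ne v r with rfl | hv
    · simp [A, parentRow]
    · have hA : A v = G.neighborFinset v := if_neg hv
      rw [updateRow_ne hv, of_apply, Finset.sum_apply, hA]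
      simp [parentRow, hv, lapMatrix, degMatrix, Matrix.diagonal_apply, Pi.single_apply,
        adjMatrix_apply, eq_comm]
  have hdet : (Matrix.of fun v ↦ ∑ w ∈ A v, parentRow r v w).det =
      ∑ f ∈ Fintype.piFinset A, (Matrix.of fun v ↦ parentRow r v (f v)).det :=
    (Matrix.detRowAlternating (n := V) (R := ℤ)).toMultilinearMap.map_sum_finset _ A
  have hmem (f : V → V) : f ∈ Fintype.piFinset A ↔ f r = r ∧ ∀ v, v ≠ r → G.Adj v (f v) := by
    rw [Fintype.mem_piFinset]
    refine ⟨fun h ↦ ⟨by simpa [A] using h r, fun v hv ↦ by simpa [A, hv] using h v⟩, ?_⟩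
    rintro ⟨h, h'⟩ v
    rcases eq_or_ne v r with rfl | hv
    · simpa [A] using h
    · simpa [A, hv] using h' v hv
  have hterm (f : V → V) (hf : f ∈ Fintype.piFinset A) :
      (Matrix.of fun v ↦ parentRow r v (f v)).det = if ∀ v, ∃ k, f^[k] v = r then 1 else 0 := by
    obtain ⟨hr, hadj⟩ := (hmem f).mp hf
    split_ifs with h
    · exact det_parentRow_of_reaches hr (fun v hv ↦ (hadj v hv).ne') h
    · exact det_parentRow_of_not_reaches h
  rw [hrows, hdet, Finset.sum_congr rfl hterm, Finset.sum_boole,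
    spanningTreeCount_eq_card_isParentMap G r, Nat.card_eq_fintype_card, Fintype.card_subtype]
  congr 2
  ext f
  rw [Finset.mem_filter, hmem, Finset.mem_filter]
  exact ⟨fun ⟨⟨h₁, h₂⟩, h₃⟩ ↦ ⟨mem_univ _, h₁, h₂, h₃⟩,
    fun ⟨_, h₁, h₂, h₃⟩ ↦ ⟨⟨h₁, h₂⟩, h₃⟩⟩

theorem sum_lapMatrix_row (G : SimpleGraph V) [DecidableRel G.Adj] (i : V) :
    ∑ j, G.lapMatrix ℤ i j = 0 := by
  simpa [Matrix.mulVec, dotProduct] using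
    congrFun (G.lapMatrix_mulVec_const_eq_zero (R := ℤ)) i

theorem sum_lapMatrix_col (G : SimpleGraph V) [DecidableRel G.Adj] (j : V) :
    ∑ i, G.lapMatrix ℤ i j = 0 := by
  simpa [(G.isSymm_lapMatrix ℤ).apply] using G.sum_lapMatrix_row j

end MatrixTree

end SimpleGraph

namespace IsFerrersGraph

variable {m n : ℕ} {G : SimpleGraph (Fin (m + 1) ⊕ Fin (n + 1))} [DecidableRel G.Adj]

/-- A ranking of the vertices along the boundary of the Ferrers diagram. -/
def boundaryRank (G : SimpleGraph (Fin (m + 1) ⊕ Fin (n + 1))) [DecidableRel G.Adj] :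
    Fin (m + 1) ⊕ Fin (n + 1) → ℕ
  | .inl i => (univ.filter fun j ↦ G.Adj (.inl i) (.inr j)).sup fun j ↦ 2 * (j : ℕ) + 2
  | .inr j => 2 * (j : ℕ) + 1

theorem adj_iff_boundaryRank_lt (hG : IsFerrersGraph G) (i : Fin (m + 1)) (j : Fin (n + 1)) :
    G.Adj (.inl i) (.inr j) ↔ boundaryRank G (.inr j) < boundaryRank G (.inl i) := by
  simp only [boundaryRank]
  rw [Finset.lt_sup_iff]
  constructor
  · exact fun h ↦ ⟨j, by simpa using h, by omega⟩
  · rintro ⟨l, hl, hlt⟩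
    exact hG.2.2.1 i i l j (by simpa using hl) le_rfl (Fin.le_def.mpr (by omega))

theorem card_mul_spanningTreeCount (hG : IsFerrersGraph G) :
    (m + 1) * (n + 1) * spanningTreeCount G = ∏ v, G.degree v := by
  let a : Fin (m + 1) ⊕ Fin (n + 1) → ℤ := Sum.elim 1 0
  let b : Fin (m + 1) ⊕ Fin (n + 1) → ℤ := Sum.elim 0 1
  have hperturb := Matrix.det_add_vecMulVec_of_sum_eq_zero (G.lapMatrix ℤ) G.sum_lapMatrix_col
    G.sum_lapMatrix_row a b (.inl 0)
  rw [G.det_lapMatrix_updateRow, Matrix.det_eq_prod_diag_of_rank _ (boundaryRank G)] at hperturb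
  · have hdiag (v) : (G.lapMatrix ℤ + Matrix.vecMulVec a b) v v = G.degree v := by
      rcases v with v | v <;>
        simp [a, b, SimpleGraph.lapMatrix, SimpleGraph.degMatrix, Matrix.vecMulVec_apply]
    simp_rw [hdiag] at hperturb
    have ha : ∑ v, a v = m + 1 := by simp [a]
    have hb : ∑ v, b v = n + 1 := by simp [b]
    rw [ha, hb] at hperturb
    exact_mod_cast hperturb.symm
  · rintro (i | i) (j | j) hne hle
    · simp [a, b, SimpleGraph.lapMatrix, SimpleGraph.degMatrix, Matrix.vecMulVec_apply, hne, hG.1]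
    · have hlt : boundaryRank G (.inr j) < boundaryRank G (.inl i) := by
        refine lt_of_le_of_ne hle fun h ↦ ?_
        have heven : Even (boundaryRank G (.inl i)) :=
          Finset.sup_induction (p := Even) (by simp)
            (fun x hx y hy ↦ by rcases max_choice x y with h | h <;> simpa [h]) fun j _ ↦ by
              simp [Nat.even_add]
        rw [← h] at heven
        simp [boundaryRank] at heven
      have := (hG.adj_iff_boundaryRank_lt i j).mpr hlt
      simp [a, b, SimpleGraph.lapMatrix, SimpleGraph.degMatrix, Matrix.vecMulVec_apply, this]
    · have : ¬ G.Adj (.inr i) (.inl j) := fun h ↦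
        absurd ((hG.adj_iff_boundaryRank_lt j i).mp h.symm) hle.not_gt
      simp [a, b, SimpleGraph.lapMatrix, SimpleGraph.degMatrix, Matrix.vecMulVec_apply, this]
    · simp [a, b, SimpleGraph.lapMatrix, SimpleGraph.degMatrix, Matrix.vecMulVec_apply, hne,
        hG.2.1]

theorem degree_inl_zero (hG : IsFerrersGraph G) : G.degree (.inl 0) = n + 1 := by
  have : G.neighborFinset (.inl 0) = univ.map Function.Embedding.inr := by
    ext (v | v)
    · simp [hG.1]
    · simpa using hG.2.2.1 0 0 _ v hG.2.2.2.1 le_rfl (Fin.le_last v)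
  rw [← SimpleGraph.card_neighborFinset_eq_degree, this]
  simp

theorem degree_inr_zero (hG : IsFerrersGraph G) : G.degree (.inr 0) = m + 1 := by
  have : G.neighborFinset (.inr 0) = univ.map Function.Embedding.inl := by
    ext (v | v)
    · simpa using (hG.2.2.1 _ v 0 0 hG.2.2.2.2 (Fin.le_last v) le_rfl).symm
    · simp [hG.2.1]
  rw [← SimpleGraph.card_neighborFinset_eq_degree, this]
  simp

end IsFerrersGraph

/-- Ehrenborg–van Willigenburg: for a Ferrers graph `G` with row part of size `m + 1`
and column part of size `n + 1`, we have `(m+1)(n+1)τ(G) = ∏_v deg(v)`; equivalently,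
`τ(G)` is the product of the degrees of all row and column vertices other than the
first ones. -/
theorem ferrers_spanning_tree_count {m n : ℕ} (G : SimpleGraph (Fin (m + 1) ⊕ Fin (n + 1)))
    [DecidableRel G.Adj] (hG : IsFerrersGraph G) :
    (m + 1) * (n + 1) * spanningTreeCount G = ∏ v, G.degree v ∧
    spanningTreeCount G =
      (∏ i ∈ Finset.Ioi (0 : Fin (m + 1)), G.degree (Sum.inl i)) *
        ∏ j ∈ Finset.Ioi (0 : Fin (n + 1)), G.degree (Sum.inr j) := by
  refine ⟨hG.card_mul_spanningTreeCount, ?_⟩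
  have hsplit (k : ℕ) (d : Fin (k + 1) → ℕ) :
      ∏ i, d i = d 0 * ∏ i ∈ Finset.Ioi 0, d i := by
    rw [← Finset.mul_prod_erase _ _ (Finset.mem_univ 0)]
    congr 2
    ext i
    simp
  have h := hG.card_mul_spanningTreeCount
  rw [Fintype.prod_sum_type, hsplit m, hsplit n, hG.degree_inl_zero, hG.degree_inr_zero] at h
  refine Nat.eq_of_mul_eq_mul_left (by positivity : 0 < (m + 1) * (n + 1)) (h.trans ?_)
  ring
end

section
/- Let G be a connected threshold graph on vertices v₁, ..., v_n (ordered as in the definition of a threshold graph), and let t ≤ n be the largest index such that {v_i, v_t} ∈ E(G) for all i < t. Then the number of spanning trees of G is τ(G) = ∏_{i=2}^{t-1} (deg(v_i) + 1) · ∏_{i=t+1}^{n} deg(v_i). -/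
/-- A simple graph on `Fin n` is threshold-ordered (with respect to the natural order of
its vertices `v₁, …, v_n`) if whenever `{v_k, v_ℓ} ∈ E(G)` with `k < ℓ`, we have
`{v_i, v_ℓ} ∈ E(G)` for all `i < k` and `{v_k, v_j} ∈ E(G)` for all `j ≠ k` with
`j < ℓ`. -/
def IsThresholdOrdered {n : ℕ} (G : SimpleGraph (Fin n)) : Prop :=
  ∀ k l : Fin n, k < l → G.Adj k l →
    (∀ i, i < k → G.Adj i l) ∧ (∀ j, j ≠ k → j < l → G.Adj k j)

namespace SpanningTree

open Finset Matrix

section ParentFunctions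

variable {V : Type*}

/-- The graph whose edges join each vertex to its image under `f`. -/
def parentGraph (f : V → V) : SimpleGraph V := SimpleGraph.fromRel fun u v => f u = v

lemma parentGraph_adj {f : V → V} {u v : V} :
    (parentGraph f).Adj u v ↔ u ≠ v ∧ (f u = v ∨ f v = u) := Iff.rfl

/-- `f` fixes `r` and every vertex is eventually mapped to `r`. -/
def IsParentFunction (r : V) (f : V → V) : Prop := f r = r ∧ ∀ v, ∃ k, f^[k] v = r

lemma parentGraph_connected {r : V} {f : V → V} (hf : IsParentFunction r f) :
    (parentGraph f).Connected := by
  have reach : ∀ v, (parentGraph f).Reachable v r := by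
    intro v
    obtain ⟨k, hk⟩ := hf.2 v
    induction k generalizing v with
    | zero => simp only [Function.iterate_zero, id] at hk; rw [hk]
    | succ k ih =>
      rw [Function.iterate_succ_apply] at hk
      by_cases h : v = f v
      · rw [h]; exact ih _ hk
      · exact (SimpleGraph.Adj.reachable (parentGraph_adj.2 ⟨h, Or.inl rfl⟩)).trans (ih _ hk)
  have : Nonempty V := ⟨r⟩
  exact ⟨fun u v => (reach u).trans (reach v).symm⟩

lemma parentGraph_isTree [Finite V] {r : V} {f : V → V} (hf : IsParentFunction r f) :
    (parentGraph f).IsTree := by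
  have hconn := parentGraph_connected hf
  rw [SimpleGraph.isTree_iff_connected_and_card]
  refine ⟨hconn, le_antisymm ?_ hconn.card_vert_le_card_edgeSet_add_one⟩
  have hsub : (parentGraph f).edgeSet ⊆ (fun v => s(v, f v)) '' ({r}ᶜ : Set V) := by
    intro e
    induction e using Sym2.ind with
    | _ u v =>
      intro h
      obtain ⟨hne, h | h⟩ := parentGraph_adj.1 h
      · refine ⟨u, ?_, by simp [h]⟩
        rintro rfl
        exact hne (hf.1.symm.trans h)
      · refine ⟨v, ?_, by simp [h, Sym2.eq_swap]⟩
        rintro rfl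
        exact hne (h.symm.trans hf.1)
  have hle : Nat.card (parentGraph f).edgeSet ≤ ({r}ᶜ : Set V).ncard :=
    (Set.ncard_le_ncard hsub (Set.toFinite _)).trans (Set.ncard_image_le (Set.toFinite _))
  have := Set.ncard_add_ncard_compl ({r} : Set V)
  rw [Set.ncard_singleton] at this
  omega

lemma IsParentFunction.apply_apply_ne {r : V} {f : V → V} (hf : IsParentFunction r f) {v : V}
    (hv : v ≠ r) : f (f v) ≠ v := by
  intro h
  obtain ⟨k, hk⟩ := hf.2 v
  have key : ∀ k, f^[k] v = v ∨ f^[k] v = f v := by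
    intro k
    induction k with
    | zero => exact Or.inl rfl
    | succ k ih =>
      rw [Function.iterate_succ_apply']
      rcases ih with ih | ih <;> rw [ih]
      · exact Or.inr rfl
      · exact Or.inl h
  rcases key k with h1 | h1
  · exact hv (h1.symm.trans hk)
  · rw [← h1, hk, hf.1] at h
    exact hv h.symm

lemma IsParentFunction.apply_ne {r : V} {f : V → V} (hf : IsParentFunction r f) {v : V}
    (hv : v ≠ r) : f v ≠ v := fun h => hf.apply_apply_ne hv (by rw [h, h])

lemma parentGraph_injOn (r : V) : Set.InjOn parentGraph {f : V → V | IsParentFunction r f} := by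
  intro f hf g hg h
  funext v
  obtain ⟨k, hk⟩ := hf.2 v
  induction k generalizing v with
  | zero =>
    simp only [Function.iterate_zero, id] at hk
    rw [hk, hf.1, hg.1]
  | succ k ih =>
    rw [Function.iterate_succ_apply] at hk
    by_cases hv : v = r
    · rw [hv, hf.1, hg.1]
    have hadj : (parentGraph f).Adj v (f v) := parentGraph_adj.2 ⟨(hf.apply_ne hv).symm, Or.inl rfl⟩
    rw [h] at hadj
    rcases (parentGraph_adj.1 hadj).2 with h1 | h1
    · exact h1.symm
    · exact absurd ((ih _ hk).trans h1) (hf.apply_apply_ne hv)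

lemma exists_adj_dist_lt {T : SimpleGraph V} (hT : T.Connected) {r v : V} (hv : v ≠ r) :
    ∃ w, T.Adj v w ∧ T.dist w r < T.dist v r := by
  obtain ⟨p, hp⟩ := hT.exists_walk_length_eq_dist v r
  cases p with
  | nil => exact absurd rfl hv
  | @cons _ w _ hadj q =>
    refine ⟨w, hadj, ?_⟩
    have := SimpleGraph.dist_le q
    simp only [SimpleGraph.Walk.length_cons] at hp
    omega

lemma exists_parentGraph_eq {T : SimpleGraph V} (hT : T.IsTree) (r : V) :
    ∃ f, IsParentFunction r f ∧ (∀ v, v ≠ r → T.Adj v (f v)) ∧ parentGraph f = T := by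
  classical
  choose g hg using fun (v : V) (hv : v ≠ r) => exists_adj_dist_lt hT.connected hv
  set f : V → V := fun v => if hv : v = r then r else g v hv with hf
  have hadj : ∀ v, v ≠ r → T.Adj v (f v) := fun v hv => by simpa [hf, hv] using (hg v hv).1
  have hdist : ∀ v, v ≠ r → T.dist (f v) r < T.dist v r := fun v hv => by
    simpa [hf, hv] using (hg v hv).2
  have hpar : IsParentFunction r f := by
    refine ⟨by simp [hf], fun v => ?_⟩
    induction hd : T.dist v r using Nat.strong_induction_on generalizing v with
    | _ d ih =>
      by_cases hv : v = r
      · exact ⟨0, hv⟩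
      · obtain ⟨k, hk⟩ := ih _ (hd ▸ hdist v hv) (f v) rfl
        exact ⟨k + 1, hk⟩
  refine ⟨f, hpar, hadj, ?_⟩
  have hle : parentGraph f ≤ T := by
    intro u v huv
    obtain ⟨hne, h | h⟩ := parentGraph_adj.1 huv
    · have hu : u ≠ r := by rintro rfl; exact hne (hpar.1.symm.trans h)
      exact h ▸ hadj u hu
    · have hv : v ≠ r := by rintro rfl; exact hne (h.symm.trans hpar.1)
      exact h ▸ (hadj v hv).symm
  exact le_antisymm hle
    ((SimpleGraph.isTree_iff_minimal_connected.1 hT).2 (parentGraph_connected hpar) hle)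

/-- Spanning trees as graphs on the same vertex set. -/
def spanningTreeEquiv (G : SimpleGraph V) :
    {T : G.Subgraph // T.IsSpanning ∧ T.coe.IsTree} ≃ {H : SimpleGraph V // H ≤ G ∧ H.IsTree} where
  toFun T := ⟨T.1.spanningCoe, T.1.spanningCoe_le,
    (T.1.spanningCoeEquivCoeOfSpanning T.2.1).isTree_iff.2 T.2.2⟩
  invFun H := ⟨SimpleGraph.toSubgraph H.1 H.2.1, SimpleGraph.toSubgraph.isSpanning _ _,
    ((SimpleGraph.toSubgraph H.1 H.2.1).spanningCoeEquivCoeOfSpanning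
      (SimpleGraph.toSubgraph.isSpanning _ _)).isTree_iff.1 H.2.2⟩
  left_inv T := by
    apply Subtype.ext
    apply SimpleGraph.Subgraph.ext
    · exact (SimpleGraph.Subgraph.isSpanning_iff.1 T.2.1).symm
    · rfl
  right_inv H := rfl

lemma spanningTreeCount_eq_card_parentFunctions [Finite V] (G : SimpleGraph V) (r : V) :
    spanningTreeCount G = {f : V → V | IsParentFunction r f ∧ ∀ v, v ≠ r → G.Adj v (f v)}.ncard := by
  rw [spanningTreeCount, Nat.card_congr (spanningTreeEquiv G),
    ← ((parentGraph_injOn r).mono fun f hf => hf.1).ncard_image]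
  change {H : SimpleGraph V | H ≤ G ∧ H.IsTree}.ncard = _
  congr 1
  ext H
  constructor
  · rintro ⟨hle, hT⟩
    obtain ⟨f, hf, hadj, rfl⟩ := exists_parentGraph_eq hT r
    exact ⟨f, ⟨hf, fun v hv => hle (hadj v hv)⟩, rfl⟩
  · rintro ⟨f, ⟨hf, hadj⟩, rfl⟩
    refine ⟨fun u v huv => ?_, parentGraph_isTree hf⟩
    obtain ⟨hne, h | h⟩ := parentGraph_adj.1 huv
    · have hu : u ≠ r := by rintro rfl; exact hne (hf.1.symm.trans h)
      exact h ▸ hadj u hu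
    · have hv : v ≠ r := by rintro rfl; exact hne (h.symm.trans hf.1)
      exact h ▸ (hadj v hv).symm

end ParentFunctions

section Determinant

variable {V : Type*} [Fintype V] [DecidableEq V]

/-- The row vector `e_v - e_u`, with the coordinate `r` of `e_u` replaced by zero. -/
def parentRow (r v u : V) : V → ℤ := fun w =>
  (if v = w then 1 else 0) - if u = w ∧ w ≠ r then 1 else 0

lemma parentMatrix_mulVec (r : V) (f : V → V) (x : V → ℤ) (v : V) :
    (Matrix.of fun v => parentRow r v (f v)).mulVec x v =
      x v - if f v = r then 0 else x (f v) := by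
  have h : ∀ w, (if f v = w ∧ w ≠ r then x w else 0) =
      if f v = w then (if w = r then 0 else x w) else 0 := by
    intro w; split_ifs <;> simp_all
  simp [Matrix.mulVec, dotProduct, parentRow, sub_mul, Finset.sum_sub_distrib, h]

open Classical in
lemma det_parentMatrix (r : V) (f : V → V) (hr : f r = r) :
    (Matrix.of fun v => parentRow r v (f v)).det = if IsParentFunction r f then 1 else 0 := by
  split_ifs with hf
  · let d : V → ℕ := fun v => Nat.find (hf.2 v)
    have hd : ∀ v, v ≠ r → d (f v) < d v := by
      intro v hv
      have h := Nat.find_spec (hf.2 v)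
      rcases hk : Nat.find (hf.2 v) with _ | k
      · rw [hk] at h; exact absurd h hv
      · rw [hk, Function.iterate_succ_apply] at h
        change Nat.find (hf.2 (f v)) < Nat.find (hf.2 v)
        rw [hk]
        exact Nat.lt_succ_of_le (Nat.find_min' _ h)
    have hlt : ∀ v w, f v = w ∧ w ≠ r → d w < d v := by
      rintro v w ⟨rfl, h⟩
      exact hd v (by rintro rfl; exact h hr)
    have htri : (Matrix.of fun v => parentRow r v (f v)).BlockTriangular
        (fun v => OrderDual.toDual (d v)) := by
      intro v w hvw
      have hvw' : d v < d w := hvw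
      have h1 : v ≠ w := by rintro rfl; exact lt_irrefl _ hvw'
      have h2 : ¬ (f v = w ∧ w ≠ r) := fun h => by have := hlt v w h; omega
      simp [parentRow, h1, h2]
    rw [htri.det]
    refine Finset.prod_eq_one fun a _ => ?_
    suffices h1 : (Matrix.of fun v => parentRow r v (f v)).toSquareBlock
        (fun v => OrderDual.toDual (d v)) a = 1 by rw [h1, Matrix.det_one]
    ext ⟨v, hv⟩ ⟨w, hw⟩
    have h2 : ¬ (f v = w ∧ w ≠ r) := fun h => by
      have := hlt v w h
      have : d v = d w := OrderDual.toDual.injective (hv.trans hw.symm)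
      omega
    simp [Matrix.toSquareBlock_def, parentRow, h2, Matrix.one_apply]
  · have : ∃ v, ∀ k, f^[k] v ≠ r := by
      by_contra! h
      exact hf ⟨hr, h⟩
    obtain ⟨v₀, hv₀⟩ := this
    rw [← Matrix.exists_mulVec_eq_zero_iff]
    refine ⟨fun v => if ∃ k, f^[k] v = r then 0 else 1, ?_, ?_⟩
    · intro h
      have := congrFun h v₀
      simp [hv₀] at this
    · funext v
      rw [parentMatrix_mulVec]
      have hiff : (∃ k, f^[k] v = r) ↔ ∃ k, f^[k] (f v) = r := by
        constructor
        · rintro ⟨k, hk⟩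
          exact ⟨k, by rw [← Function.iterate_succ_apply, Function.iterate_succ_apply', hk, hr]⟩
        · rintro ⟨k, hk⟩
          exact ⟨k + 1, hk⟩
      have h0 : f v = r → ∃ k, f^[k] (f v) = r := fun h => ⟨0, h⟩
      simp only [hiff]
      split_ifs <;> simp_all

variable (G : SimpleGraph V) [DecidableRel G.Adj]

/-- The Laplacian of `G` with row and column `r` replaced by those of the identity matrix. -/
def groundedLaplacian (r : V) : Matrix V V ℤ := Matrix.of fun v =>
  ∑ u ∈ if v = r then {r} else G.neighborFinset v, parentRow r v u

lemma groundedLaplacian_mulVec_self (r : V) (x : V → ℤ) :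
    (groundedLaplacian G r).mulVec x r = x r := by
  simp [groundedLaplacian, Matrix.mulVec, dotProduct, parentRow, sub_mul, ite_and]

lemma groundedLaplacian_mulVec {r v : V} (hv : v ≠ r) (x : V → ℤ) :
    (groundedLaplacian G r).mulVec x v =
      G.degree v * x v - ∑ u ∈ G.neighborFinset v, if u = r then 0 else x u := by
  have h := fun u => parentMatrix_mulVec r (fun _ => u) x v
  simp only [Matrix.mulVec, dotProduct, Matrix.of_apply] at h
  simp only [groundedLaplacian, Matrix.mulVec, dotProduct, Matrix.of_apply, if_neg hv,
    Finset.sum_apply, Finset.sum_mul]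
  rw [Finset.sum_comm]
  simp [h, Finset.sum_sub_distrib]

/-- A form of the matrix-tree theorem. -/
theorem spanningTreeCount_eq_det (r : V) :
    (spanningTreeCount G : ℤ) = (groundedLaplacian G r).det := by
  classical
  have h := (Matrix.detRowAlternating (R := ℤ) (n := V)).toMultilinearMap.map_sum_finset
    (fun v u => parentRow r v u) (fun v => if v = r then {r} else G.neighborFinset v)
  change (groundedLaplacian G r).det = _ at h
  rw [h, spanningTreeCount_eq_card_parentFunctions G r]
  have hdet : ∀ f ∈ Fintype.piFinset (fun v => if v = r then {r} else G.neighborFinset v),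
      (Matrix.detRowAlternating (R := ℤ) (n := V)).toMultilinearMap
        (fun v => parentRow r v (f v)) = if IsParentFunction r f then 1 else 0 := by
    intro f hf
    refine det_parentMatrix r f ?_
    simpa using Fintype.mem_piFinset.1 hf r
  rw [Finset.sum_congr rfl hdet, Finset.sum_boole, ← Set.ncard_coe_finset]
  congr 2
  ext f
  simp only [Set.mem_ofPred_eq, Finset.coe_filter, Fintype.mem_piFinset]
  constructor
  · rintro ⟨hf, hadj⟩
    refine ⟨fun v => ?_, hf⟩
    by_cases hv : v = r
    · simp [hv, hf.1]
    · simpa [hv] using hadj v hv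
  · rintro ⟨hmem, hf⟩
    refine ⟨hf, fun v hv => ?_⟩
    simpa [hv] using hmem v

end Determinant

end SpanningTree

section Threshold

open Finset Matrix SpanningTree

variable {n : ℕ} {G : SimpleGraph (Fin (n + 1))} {t : Fin (n + 1)}

lemma IsThresholdOrdered.adj_zero (hG : IsThresholdOrdered G) (hconn : G.Connected)
    {v : Fin (n + 1)} (hv : v ≠ 0) : G.Adj 0 v := by
  have : Nontrivial (Fin (n + 1)) := ⟨v, 0, hv⟩
  obtain ⟨k, hk⟩ := hconn.preconnected.exists_adj_of_nontrivial v
  have hv0 : 0 < v := Fin.pos_of_ne_zero hv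
  rcases lt_or_gt_of_ne hk.ne with h | h
  · exact ((hG v k h hk).2 0 hv.symm (hv0.trans h)).symm
  · by_cases hk0 : k = 0
    · exact hk0 ▸ hk.symm
    · exact (hG k v h hk.symm).1 0 (Fin.pos_of_ne_zero hk0)

lemma IsThresholdOrdered.adj_of_le (hG : IsThresholdOrdered G) (ht : ∀ i, i < t → G.Adj i t)
    {u v : Fin (n + 1)} (huv : u < v) (hv : v ≤ t) : G.Adj u v := by
  rcases hv.lt_or_eq with h | rfl
  · exact ((hG v t h (ht v h)).2 u huv.ne (huv.trans h)).symm
  · exact ht u huv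

lemma IsThresholdOrdered.lt_of_adj (hG : IsThresholdOrdered G)
    (htmax : ∀ s : Fin (n + 1), (∀ i, i < s → G.Adj i s) → s ≤ t)
    {u v : Fin (n + 1)} (huv : u < v) (hv : t < v) (h : G.Adj u v) : u < t := by
  by_contra! htu
  rcases htu.lt_or_eq with htu | rfl
  · exact absurd (htmax u fun i hi => ((hG u v huv h).2 i hi.ne (hi.trans huv)).symm) (not_le.2 htu)
  · have hs : (t : ℕ) + 1 < n + 1 := by have := v.2; omega
    have huv' : (t : ℕ) < v := huv
    have hts : G.Adj t ⟨t + 1, hs⟩ := by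
      by_cases hsv : (⟨t + 1, hs⟩ : Fin (n + 1)) = v
      · rwa [hsv]
      · refine (hG t v huv h).2 _ (by simp [Fin.ext_iff]) ?_
        simp only [Fin.lt_def, Fin.ext_iff] at *
        omega
    have := htmax ⟨t + 1, hs⟩ fun i hi => by
      by_cases hit : i = t
      · rwa [hit]
      · refine (hG t _ (by simp [Fin.lt_def]) hts).1 i ?_
        simp only [Fin.lt_def, Fin.ext_iff] at *
        omega
    simp [Fin.le_def] at this

variable [DecidableRel G.Adj]

variable (G t) in
/-- The vertices preceding `v` when the threshold graph is built from `t` by successively adding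
isolated and dominating vertices. -/
def earlierVertices (v : Fin (n + 1)) : Finset (Fin (n + 1)) :=
  univ.filter fun u => if v ≤ t then v < u ∧ G.Adj u v else u < v ∧ ¬ G.Adj u v

variable (G t) in
/-- The Laplacian eigenvector attached to the vertex `v`. -/
def thresholdVec (v w : Fin (n + 1)) : ℤ :=
  (if w ∈ earlierVertices G t v then 1 else 0) -
    if w = v then ((earlierVertices G t v).card : ℤ) else 0

lemma mem_earlierVertices {u v : Fin (n + 1)} : u ∈ earlierVertices G t v ↔
    (v ≤ t ∧ v < u ∧ G.Adj u v) ∨ (t < v ∧ u < v ∧ ¬ G.Adj u v) := by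
  rw [← not_le (a := v) (b := t)]
  simp only [earlierVertices, mem_filter, mem_univ, true_and]
  split_ifs with h <;> simp [h]

lemma sum_thresholdVec (v : Fin (n + 1)) : ∑ w, thresholdVec G t v w = 0 := by
  simp [thresholdVec, Finset.sum_sub_distrib]

lemma notMem_earlierVertices_self (v : Fin (n + 1)) : v ∉ earlierVertices G t v := by
  simp [mem_earlierVertices]

lemma zero_notMem_earlierVertices (hG : IsThresholdOrdered G) (hconn : G.Connected)
    (v : Fin (n + 1)) : 0 ∉ earlierVertices G t v := by
  rw [mem_earlierVertices]
  rintro (⟨-, h, -⟩ | ⟨-, h, hn⟩)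
  · exact absurd h (by simp)
  · exact hn (hG.adj_zero hconn h.ne')

lemma thresholdVec_zero (hG : IsThresholdOrdered G) (hconn : G.Connected)
    {v : Fin (n + 1)} (hv : v ≠ 0) : thresholdVec G t v 0 = 0 := by
  simp [thresholdVec, zero_notMem_earlierVertices hG hconn, hv.symm]

lemma earlierVertices_total (hG : IsThresholdOrdered G) (ht : ∀ i, i < t → G.Adj i t)
    (htmax : ∀ s : Fin (n + 1), (∀ i, i < s → G.Adj i s) → s ≤ t) {u v : Fin (n + 1)} (huv : u ≠ v) :
    u ∈ earlierVertices G t v ∨ v ∈ earlierVertices G t u := by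
  have h1 := fun a b => hG.adj_of_le (u := a) (v := b) ht
  have h2 := fun a b => hG.lt_of_adj (u := a) (v := b) htmax
  simp only [mem_earlierVertices]
  clear htmax
  have := G.adj_comm u v
  grind

lemma earlierVertices_trans (hG : IsThresholdOrdered G) (ht : ∀ i, i < t → G.Adj i t)
    (htmax : ∀ s : Fin (n + 1), (∀ i, i < s → G.Adj i s) → s ≤ t)
    {u v w : Fin (n + 1)} (huv : u ∈ earlierVertices G t v) (hvw : v ∈ earlierVertices G t w) :
    u ∈ earlierVertices G t w := by
  have h1 := fun a b => hG.adj_of_le (u := a) (v := b) ht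
  have h2 := fun a b => hG.lt_of_adj (u := a) (v := b) htmax
  have h3 := fun i k l hik hkl h => (hG k l hkl h).1 i hik
  have h4 := fun j k l hkl h => (hG k l hkl h).2 j
  have hc := fun a b => G.adj_comm a b
  simp only [mem_earlierVertices] at *
  clear hG ht htmax
  grind

lemma neighborFinset_filter_notMem_of_le (hG : IsThresholdOrdered G)
    (ht : ∀ i, i < t → G.Adj i t)
    (htmax : ∀ s : Fin (n + 1), (∀ i, i < s → G.Adj i s) → s ≤ t) {v w : Fin (n + 1)} (hv : v ≤ t)
    (hw : w ∈ earlierVertices G t v) :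
    (G.neighborFinset w).filter (· ∉ earlierVertices G t v) = Iic v := by
  have h1 := fun a b => hG.adj_of_le (u := a) (v := b) ht
  have h2 := fun a b => hG.lt_of_adj (u := a) (v := b) htmax
  have h3 := fun i k l hik hkl h => (hG k l hkl h).1 i hik
  have h4 := fun j k l hkl h => (hG k l hkl h).2 j
  have hc := fun a b => G.adj_comm a b
  ext u
  simp only [mem_earlierVertices, mem_filter, SimpleGraph.mem_neighborFinset, mem_Iic] at *
  clear hG ht htmax
  grind

lemma neighborFinset_filter_notMem_of_lt (hG : IsThresholdOrdered G)
    (ht : ∀ i, i < t → G.Adj i t)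
    (htmax : ∀ s : Fin (n + 1), (∀ i, i < s → G.Adj i s) → s ≤ t) {v w : Fin (n + 1)} (hv : t < v)
    (hw : w ∈ earlierVertices G t v) :
    (G.neighborFinset w).filter (· ∉ earlierVertices G t v) = G.neighborFinset v := by
  have h1 := fun a b => hG.adj_of_le (u := a) (v := b) ht
  have h2 := fun a b => hG.lt_of_adj (u := a) (v := b) htmax
  have h3 := fun i k l hik hkl h => (hG k l hkl h).1 i hik
  have h4 := fun j k l hkl h => (hG k l hkl h).2 j
  have hc := fun a b => G.adj_comm a b
  have hirr := fun a => G.irrefl (v := a)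
  ext u
  simp only [mem_earlierVertices, mem_filter, SimpleGraph.mem_neighborFinset] at *
  clear hG ht htmax
  grind

lemma neighborFinset_filter_mem (hG : IsThresholdOrdered G)
    (ht : ∀ i, i < t → G.Adj i t)
    (htmax : ∀ s : Fin (n + 1), (∀ i, i < s → G.Adj i s) → s ≤ t) {v w : Fin (n + 1)} (hwv : w ≠ v)
    (hw : w ∉ earlierVertices G t v) :
    (G.neighborFinset w).filter (· ∈ earlierVertices G t v) =
      if G.Adj w v then earlierVertices G t v else ∅ := by
  have h1 := fun a b => hG.adj_of_le (u := a) (v := b) ht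
  have h2 := fun a b => hG.lt_of_adj (u := a) (v := b) htmax
  have h3 := fun i k l hik hkl h => (hG k l hkl h).1 i hik
  have h4 := fun j k l hkl h => (hG k l hkl h).2 j
  have hc := fun a b => G.adj_comm a b
  split_ifs with hadj <;> ext u <;>
  simp only [mem_earlierVertices, mem_filter, SimpleGraph.mem_neighborFinset, notMem_empty] at * <;>
  clear hG ht htmax <;> grind

lemma neighborFinset_filter_mem_self (v : Fin (n + 1)) :
    (G.neighborFinset v).filter (· ∈ earlierVertices G t v) =
      if v ≤ t then earlierVertices G t v else ∅ := by
  have hc := fun a b => G.adj_comm a b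
  split_ifs with h <;> ext u <;>
  simp only [mem_earlierVertices, mem_filter, SimpleGraph.mem_neighborFinset, notMem_empty] <;>
  grind

lemma degree_eq_add_card_earlierVertices (hG : IsThresholdOrdered G)
    (ht : ∀ i, i < t → G.Adj i t) {v : Fin (n + 1)} (hv : v ≤ t) :
    G.degree v = v + (earlierVertices G t v).card := by
  have h := card_filter_add_card_filter_not (s := G.neighborFinset v)
    (· ∈ earlierVertices G t v)
  have h2 : (G.neighborFinset v).filter (· ∉ earlierVertices G t v) = Iio v := by
    have h1 := fun a b => hG.adj_of_le (u := a) (v := b) ht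
    have hc := fun a b => G.adj_comm a b
    ext u
    have := G.irrefl (v := v)
    simp only [mem_earlierVertices, mem_filter, SimpleGraph.mem_neighborFinset, mem_Iio]
    grind
  rw [neighborFinset_filter_mem_self, if_pos hv, h2, Fin.card_Iio,
    SimpleGraph.card_neighborFinset_eq_degree] at h
  omega

variable (G t) in
/-- The Laplacian eigenvalue attached to the vertex `v`. -/
def thresholdEigenvalue (v : Fin (n + 1)) : ℕ := if v ≤ t then G.degree v + 1 else G.degree v

lemma groundedLaplacian_mulVec_thresholdVec (hG : IsThresholdOrdered G) (hconn : G.Connected)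
    (ht : ∀ i, i < t → G.Adj i t)
    (htmax : ∀ s : Fin (n + 1), (∀ i, i < s → G.Adj i s) → s ≤ t) {v : Fin (n + 1)} (hv : v ≠ 0) :
    (groundedLaplacian G 0).mulVec (thresholdVec G t v) =
      (thresholdEigenvalue G t v : ℤ) • thresholdVec G t v := by
  have h0 := thresholdVec_zero (t := t) hG hconn hv
  funext w
  rw [Pi.smul_apply, smul_eq_mul]
  by_cases hw : w = 0
  · rw [hw, groundedLaplacian_mulVec_self, h0, mul_zero]
  have hx : ∀ u, (if u = 0 then 0 else thresholdVec G t v u) = thresholdVec G t v u := by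
    intro u
    split_ifs with h
    · rw [h, h0]
    · rfl
  have hsum : ∑ u ∈ G.neighborFinset w, thresholdVec G t v u =
      ((G.neighborFinset w).filter (· ∈ earlierVertices G t v)).card -
        if G.Adj w v then ((earlierVertices G t v).card : ℤ) else 0 := by
    simp [thresholdVec, Finset.sum_sub_distrib, Finset.filter_mem_eq_inter]
  rw [groundedLaplacian_mulVec G hw]
  simp only [hx, hsum]
  by_cases hwv : w = v
  · subst hwv
    rw [neighborFinset_filter_mem_self]
    simp only [thresholdVec, notMem_earlierVertices_self, SimpleGraph.irrefl, thresholdEigenvalue,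
      if_true, if_false]
    split_ifs <;> simp
    ring
  by_cases hmem : w ∈ earlierVertices G t v
  · have hcard := card_filter_add_card_filter_not (s := G.neighborFinset w)
      (· ∈ earlierVertices G t v)
    rw [SimpleGraph.card_neighborFinset_eq_degree] at hcard
    simp only [thresholdVec, hmem, hwv, thresholdEigenvalue]
    rw [mem_earlierVertices] at hmem
    by_cases hvt : v ≤ t
    · have hadj : G.Adj w v := by
        rcases hmem with h | h
        · exact h.2.2
        · exact absurd h.1 (not_lt.2 hvt)
      rw [neighborFinset_filter_notMem_of_le hG ht htmax hvt (mem_earlierVertices.2 hmem),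
        Fin.card_Iic] at hcard
      have hdeg := degree_eq_add_card_earlierVertices hG ht hvt
      simp only [hadj, hvt, if_true, if_false]
      push_cast
      zify at hcard hdeg
      linarith
    · have hadj : ¬ G.Adj w v := by
        rcases hmem with h | h
        · exact absurd h.1 hvt
        · exact h.2.2
      rw [neighborFinset_filter_notMem_of_lt hG ht htmax (not_le.1 hvt)
        (mem_earlierVertices.2 hmem), SimpleGraph.card_neighborFinset_eq_degree] at hcard
      simp only [hadj, hvt, if_true, if_false]
      zify at hcard
      linarith
  · rw [neighborFinset_filter_mem hG ht htmax hwv hmem]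
    simp only [thresholdVec, hmem, hwv, if_false]
    split_ifs <;> simp

variable (G t) in
/-- An orthogonal eigenbasis of the grounded Laplacian. -/
def thresholdBasis (v : Fin (n + 1)) : Fin (n + 1) → ℤ :=
  if v = 0 then Pi.single 0 1 else if v = t then fun w => if w = 0 then 0 else 1
  else thresholdVec G t v

lemma thresholdBasis_zero : thresholdBasis G t 0 = Pi.single 0 1 := if_pos rfl

lemma thresholdVec_dotProduct_of_mem (hG : IsThresholdOrdered G)
    (ht : ∀ i, i < t → G.Adj i t)
    (htmax : ∀ s : Fin (n + 1), (∀ i, i < s → G.Adj i s) → s ≤ t) {u v : Fin (n + 1)}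
    (h : u ∈ earlierVertices G t v) : thresholdVec G t u ⬝ᵥ thresholdVec G t v = 0 := by
  rw [← sum_thresholdVec (G := G) (t := t) u]
  refine Finset.sum_congr rfl fun w _ => ?_
  by_cases hw : w ∈ earlierVertices G t u ∨ w = u
  · have hmem : w ∈ earlierVertices G t v := by
      rcases hw with hw | rfl
      · exact earlierVertices_trans hG ht htmax hw h
      · exact h
    have hne : w ≠ v := by rintro rfl; exact notMem_earlierVertices_self _ hmem
    have : thresholdVec G t v w = 1 := by simp [thresholdVec, hmem, hne]
    rw [this, mul_one]
  · rw [not_or] at hw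
    have : thresholdVec G t u w = 0 := by simp [thresholdVec, hw.1, hw.2]
    rw [this, zero_mul]

lemma thresholdBasis_dotProduct (hG : IsThresholdOrdered G) (hconn : G.Connected)
    (ht : ∀ i, i < t → G.Adj i t)
    (htmax : ∀ s : Fin (n + 1), (∀ i, i < s → G.Adj i s) → s ≤ t) {u v : Fin (n + 1)}
    (huv : u ≠ v) : thresholdBasis G t u ⬝ᵥ thresholdBasis G t v = 0 := by
  have hzero : ∀ v, v ≠ 0 → thresholdBasis G t v 0 = 0 := by
    intro v hv
    simp only [thresholdBasis, hv, if_false]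
    split_ifs
    · rfl
    · exact thresholdVec_zero hG hconn hv
  have hones : ∀ v, v ≠ 0 →
      thresholdVec G t v ⬝ᵥ (fun w => if w = 0 then (0 : ℤ) else 1) = 0 := by
    intro v hv
    refine Eq.trans ?_ (sum_thresholdVec (G := G) (t := t) v)
    refine Finset.sum_congr rfl fun w _ => ?_
    dsimp only
    split_ifs with hw
    · rw [hw, thresholdVec_zero hG hconn hv, mul_zero]
    · rw [mul_one]
  by_cases hu : u = 0
  · rw [hu, thresholdBasis_zero, single_dotProduct, hzero v (hu ▸ huv.symm), mul_zero]
  by_cases hv : v = 0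
  · rw [hv, thresholdBasis_zero, dotProduct_single, hzero u hu, zero_mul]
  simp only [thresholdBasis, hu, hv, if_false]
  split_ifs with h1 h2 h2
  · exact absurd (h1.trans h2.symm) huv
  · rw [dotProduct_comm]; exact hones v hv
  · exact hones u hu
  · rcases earlierVertices_total hG ht htmax huv with h | h
    · exact thresholdVec_dotProduct_of_mem hG ht htmax h
    · rw [dotProduct_comm]; exact thresholdVec_dotProduct_of_mem hG ht htmax h

lemma thresholdBasis_ne_zero (hG : IsThresholdOrdered G) (ht : ∀ i, i < t → G.Adj i t)
    (htmax : ∀ s : Fin (n + 1), (∀ i, i < s → G.Adj i s) → s ≤ t) (v : Fin (n + 1)) :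
    thresholdBasis G t v ≠ 0 := by
  intro h
  have hv := congrFun h v
  by_cases h0 : v = 0
  · simp [thresholdBasis, h0] at hv
  by_cases h1 : v = t
  · simp [thresholdBasis, h0, if_pos h1] at hv
  have hmem : t ∈ earlierVertices G t v := by
    rw [mem_earlierVertices]
    rcases lt_or_gt_of_ne h1 with h | h
    · exact Or.inl ⟨h.le, h, (ht v h).symm⟩
    · exact Or.inr ⟨h, h, fun hadj => lt_irrefl _ (hG.lt_of_adj htmax h h hadj)⟩
  simp [thresholdBasis, h0, h1, thresholdVec, notMem_earlierVertices_self] at hv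
  simp [hv] at hmem

lemma groundedLaplacian_mulVec_thresholdBasis (hG : IsThresholdOrdered G) (hconn : G.Connected)
    (ht : ∀ i, i < t → G.Adj i t)
    (htmax : ∀ s : Fin (n + 1), (∀ i, i < s → G.Adj i s) → s ≤ t) (v : Fin (n + 1)) :
    (groundedLaplacian G 0).mulVec (thresholdBasis G t v) =
      (if v = 0 ∨ v = t then 1 else (thresholdEigenvalue G t v : ℤ)) • thresholdBasis G t v := by
  by_cases h0 : v = 0
  · funext w
    by_cases hw : w = 0
    · simp [hw, groundedLaplacian_mulVec_self, h0]
    · rw [groundedLaplacian_mulVec G hw, Finset.sum_eq_zero]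
      · simp [thresholdBasis, h0, hw]
      · intro u _
        split_ifs with hu <;> simp [thresholdBasis, h0, hu]
  by_cases h1 : v = t
  · funext w
    by_cases hw : w = 0
    · simp [hw, groundedLaplacian_mulVec_self, h1]
    · rw [groundedLaplacian_mulVec G hw]
      have hadj : 0 ∈ G.neighborFinset w := by
        simpa using (hG.adj_zero hconn hw).symm
      have hsum : ∑ u ∈ G.neighborFinset w, (if u = 0 then (0 : ℤ) else 1) =
          G.degree w - 1 := by
        have : ∀ u : Fin (n + 1), (if u = 0 then (0 : ℤ) else 1) = 1 - if u = 0 then 1 else 0 := by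
          intro u; split_ifs <;> simp
        simp only [this, Finset.sum_sub_distrib, Finset.sum_ite_eq', hadj, if_true]
        simp
      have hb : thresholdBasis G t v = fun w => if w = 0 then 0 else 1 := by
        simp only [thresholdBasis, h0, if_false, if_pos h1]
      have hb' : ∀ u : Fin (n + 1), (if u = 0 then (0 : ℤ) else if u = 0 then 0 else 1) =
          if u = 0 then 0 else 1 := by intro u; split_ifs <;> rfl
      simp [hb, hb', hsum, hw, if_pos (Or.inr h1 : v = 0 ∨ v = t)]
  · simp only [thresholdBasis, h0, h1, if_false, or_self]
    exact groundedLaplacian_mulVec_thresholdVec hG hconn ht htmax h0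

end Threshold

/-- For a connected threshold graph on vertices `v₁, …, v_{n+1}` (zero-indexed here by
`Fin (n+1)`), with `t` the largest index such that `{v_i, v_t} ∈ E(G)` for all `i < t`,
the number of spanning trees is
`τ(G) = ∏_{i=2}^{t-1} (deg vᵢ + 1) · ∏_{i=t+1}^{n+1} deg vᵢ`. -/
theorem threshold_spanning_tree_count {n : ℕ} (G : SimpleGraph (Fin (n + 1)))
    [DecidableRel G.Adj] (hG : IsThresholdOrdered G) (hconn : G.Connected)
    (t : Fin (n + 1)) (ht : ∀ i, i < t → G.Adj i t)
    (htmax : ∀ s : Fin (n + 1), (∀ i, i < s → G.Adj i s) → s ≤ t) :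
    spanningTreeCount G =
      (∏ i ∈ Finset.Ioo (0 : Fin (n + 1)) t, (G.degree i + 1)) *
        ∏ i ∈ Finset.Ioi t, G.degree i := by
  let B : Matrix (Fin (n + 1)) (Fin (n + 1)) ℤ := Matrix.of fun v => thresholdBasis G t v
  let d : Fin (n + 1) → ℤ := fun v => if v = 0 ∨ v = t then 1 else (thresholdEigenvalue G t v : ℤ)
  have hgram : B * B.transpose = Matrix.diagonal fun v =>
      thresholdBasis G t v ⬝ᵥ thresholdBasis G t v := by
    ext u v
    rw [Matrix.diagonal_apply]
    split_ifs with h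
    · subst h; rfl
    · exact thresholdBasis_dotProduct hG hconn ht htmax h
  have hB : B.transpose.det ≠ 0 := by
    intro h
    have hdet := congrArg Matrix.det hgram
    rw [Matrix.det_mul, h, mul_zero, Matrix.det_diagonal, eq_comm, Finset.prod_eq_zero_iff] at hdet
    obtain ⟨v, -, hv⟩ := hdet
    exact thresholdBasis_ne_zero hG ht htmax v (dotProduct_self_eq_zero.1 hv)
  have heig : SpanningTree.groundedLaplacian G 0 * B.transpose =
      B.transpose * Matrix.diagonal d := by
    ext w v
    rw [Matrix.mul_diagonal, mul_comm]
    exact congrFun (groundedLaplacian_mulVec_thresholdBasis hG hconn ht htmax v) w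
  have hdet := congrArg Matrix.det heig
  rw [Matrix.det_mul, Matrix.det_mul, mul_comm, Matrix.det_diagonal] at hdet
  have hprod := mul_left_cancel₀ hB hdet
  rw [← SpanningTree.spanningTreeCount_eq_det] at hprod
  zify
  rw [hprod]
  have hd : ∀ v, d v = (if v ∈ Finset.Ioo 0 t then (G.degree v + 1 : ℤ) else 1) *
      if v ∈ Finset.Ioi t then (G.degree v : ℤ) else 1 := by
    intro v
    have h0 : v = 0 ∨ 0 < v := (Fin.zero_le v).eq_or_lt.imp Eq.symm id
    simp only [d, thresholdEigenvalue, Finset.mem_Ioo, Finset.mem_Ioi]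
    rcases h0 with h0 | h0
    · subst h0; simp
    rcases lt_trichotomy v t with h | h | h
    · simp [h0.ne', h.ne, h.le, h0, h, h.not_gt]
    · simp [h]
    · simp [h0.ne', h.ne', h.not_ge, h, h.not_gt]
  rw [Finset.prod_congr rfl fun v _ => hd v, Finset.prod_mul_distrib]
  simp only [Finset.prod_ite_mem, Finset.univ_inter]
end
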